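/- arXiv:1510.00295 — 12 statements merged into one kernel-verified Lean document; each statement's English description precedes it below -/
import Mathlib

section
/- Let v be an α-near-submodular valuation on a finite item set Ω (α ≥ 1), let S and T be disjoint finite subsets of Ω, and let p and q be price vectors. Assume that for every x ∈ T we have v(S ∪ T) − v((S ∪ T) \ {x}) ≥ q(x). If a set X ⊆ S ∪ T satisfies α·v(X) ≥ p(X ∩ S) + q(X \ S), then for every x ∈ T \ X we have α·v(X ∪ {x}) ≥ p(X ∩ S) + q((X ∪ {x}) \ S). -/
/-- Claim 1 (extending an α-near-submodular rationality bound by one item of the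
conditional bid). -/
theorem smra_claim_one_item
    {ι : Type*} [Fintype ι] [DecidableEq ι]
    (α : ℝ) (hα : 1 ≤ α)
    (v : Finset ι → ℝ)
    (hv0 : v ∅ = 0)
    (hmono : ∀ A B : Finset ι, A ⊆ B → v A ≤ v B)
    (hns : ∀ A B : Finset ι, A ⊆ B → ∀ x ∉ B,
      α * (v (insert x A) - v A) ≥ v (insert x B) - v B)
    (p q : ι → ℝ) (hp : ∀ j, 0 ≤ p j) (hq : ∀ j, 0 ≤ q j)
    (S T : Finset ι) (hST : Disjoint S T)
    (hbid : ∀ x ∈ T, v (S ∪ T) - v ((S ∪ T) \ {x}) ≥ q x)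
    (X : Finset ι) (hX : X ⊆ S ∪ T)
    (hXrat : α * v X ≥ (∑ j ∈ X ∩ S, p j) + ∑ j ∈ X \ S, q j) :
    ∀ x ∈ T \ X,
      α * v (insert x X) ≥ (∑ j ∈ X ∩ S, p j) + ∑ j ∈ (insert x X) \ S, q j := by
  intro x hx
  obtain ⟨hxT, hxX⟩ := Finset.mem_sdiff.mp hx
  have hxS : x ∉ S := Finset.disjoint_right.mp hST hxT
  have hsub : X ⊆ (S ∪ T) \ {x} := by
    rw [Finset.sdiff_singleton_eq_erase]
    exact Finset.subset_erase.mpr ⟨hX, hxX⟩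
  have hmarg := hns X ((S ∪ T) \ {x}) hsub x (by simp)
  have hins : insert x ((S ∪ T) \ {x}) = S ∪ T := by
    rw [Finset.sdiff_singleton_eq_erase]
    exact Finset.insert_erase (Finset.mem_union_right S hxT)
  rw [hins] at hmarg
  have hqx := hbid x hxT
  rw [Finset.insert_sdiff_of_notMem X hxS, Finset.sum_insert (by simp [hxX])]
  linarith
end

section
/- Let v be an α-near-submodular valuation on a finite item set Ω (α ≥ 1), let S and T be disjoint finite subsets of Ω, and let p and q be price vectors. Assume that for every x ∈ T we have v(S ∪ T) − v((S ∪ T) \ {x}) ≥ q(x). If X ⊆ S satisfies α·v(X) ≥ p(X), then for every subset X̂ ⊆ T we have α·v(X ∪ X̂) ≥ p(X) + q(X̂). -/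
/-- Claim 2 (iterating the one-item extension over a subset of the conditional
bid). -/
theorem smra_claim_subset_extension
    {ι : Type*} [Fintype ι] [DecidableEq ι]
    (α : ℝ) (hα : 1 ≤ α)
    (v : Finset ι → ℝ)
    (hv0 : v ∅ = 0)
    (hmono : ∀ A B : Finset ι, A ⊆ B → v A ≤ v B)
    (hns : ∀ A B : Finset ι, A ⊆ B → ∀ x ∉ B,
      α * (v (insert x A) - v A) ≥ v (insert x B) - v B)
    (p q : ι → ℝ) (hp : ∀ j, 0 ≤ p j) (hq : ∀ j, 0 ≤ q j)
    (S T : Finset ι) (hST : Disjoint S T)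
    (hbid : ∀ x ∈ T, v (S ∪ T) - v ((S ∪ T) \ {x}) ≥ q x)
    (X : Finset ι) (hX : X ⊆ S)
    (hXrat : α * v X ≥ ∑ j ∈ X, p j) :
    ∀ Xhat ⊆ T, α * v (X ∪ Xhat) ≥ (∑ j ∈ X, p j) + ∑ j ∈ Xhat, q j := by
  intro Xhat
  induction Xhat using Finset.induction_on with
  | empty => intro _; simpa using hXrat
  | insert x Y hxY ih =>
    intro hsub
    obtain ⟨hxT, hYT⟩ := Finset.insert_subset_iff.mp hsub
    have hxX : x ∉ X := fun h => Finset.disjoint_left.mp hST (hX h) hxT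
    have hAB : X ∪ Y ⊆ (S ∪ T) \ {x} := by
      rw [Finset.sdiff_singleton_eq_erase]
      exact Finset.subset_erase.mpr
        ⟨Finset.union_subset_union hX hYT, by simp [hxX, hxY]⟩
    have hmarg := hns (X ∪ Y) ((S ∪ T) \ {x}) hAB x (by simp)
    have hins : insert x ((S ∪ T) \ {x}) = S ∪ T := by
      rw [Finset.sdiff_singleton_eq_erase]
      exact Finset.insert_erase (Finset.mem_union_right S hxT)
    rw [hins] at hmarg
    rw [Finset.union_insert, Finset.sum_insert hxY]
    linarith [ih hYT, hbid x hxT]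
end

section
/- Let v be an α-near-submodular valuation on a finite item set Ω (α ≥ 1). Consider sequences indexed by rounds t ∈ ℕ: price vectors p_t, provisional sets S_t ⊆ Ω, and conditional bids T_t ⊆ Ω, satisfying: S_0 = ∅; p_0(j) = 0 for all j; for every t, T_t is disjoint from S_t; S_{t+1} ⊆ S_t ∪ T_t; p_{t+1}(j) = p_t(j) for every j ∈ S_t ∩ S_{t+1}; and for every x ∈ T_t, v(S_t ∪ T_t) − v((S_t ∪ T_t) \ {x}) ≥ p_{t+1}(x). Then for every round t and every subset S' ⊆ S_t, α·v(S') ≥ p_t(S'). In particular, the allocation is α-individually rational in every round. -/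
/-- If each element of `Q` has marginal value at least `c` at the top of `U`, then adding `Q` to a
set `R ⊆ U` disjoint from it gains at least `∑ x ∈ Q, c x`, up to the factor `α`. -/
lemma sum_le_mul_sub_of_near_submodular {ι : Type*} [DecidableEq ι] {α : ℝ} {v : Finset ι → ℝ}
    (hns : ∀ A B : Finset ι, A ⊆ B → ∀ x ∉ B,
      α * (v (insert x A) - v A) ≥ v (insert x B) - v B)
    {U R : Finset ι} (hR : R ⊆ U) {c : ι → ℝ} (Q : Finset ι) (hQ : Q ⊆ U) (hRQ : Disjoint R Q)
    (hc : ∀ x ∈ Q, c x ≤ v U - v (U \ {x})) :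
    ∑ x ∈ Q, c x ≤ α * (v (R ∪ Q) - v R) := by
  induction Q using Finset.induction_on with
  | empty => simp
  | insert x Q hx ih =>
    rw [Finset.insert_subset_iff] at hQ
    rw [Finset.disjoint_insert_right] at hRQ
    have hrec := ih hQ.2 hRQ.2 fun y hy => hc y (Finset.mem_insert_of_mem hy)
    have hsub : R ∪ Q ⊆ U \ {x} := by
      intro y hy
      rw [Finset.mem_sdiff, Finset.mem_singleton]
      refine ⟨Finset.union_subset hR hQ.2 hy, ?_⟩
      rintro rfl
      exact (Finset.mem_union.mp hy).elim hRQ.1 hx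
    have hmarg := hns _ _ hsub x (by simp)
    have htop : insert x (U \ {x}) = U := by
      rw [Finset.sdiff_singleton_eq_erase, Finset.insert_erase hQ.1]
    rw [htop] at hmarg
    have hcx := hc x (Finset.mem_insert_self x Q)
    rw [Finset.sum_insert hx, Finset.union_insert]
    linarith


/-- Theorem (α-individual rationality of the SMRA under truthful bidding).
Under the round-by-round dynamics of the SMRA with an α-near-submodular valuation, every
subset `S'` of the provisional set at every round satisfies `α·v(S') ≥ p_t(S')`; in
particular the bidder is α-individually rational in every round. -/
theorem smra_truthful_alpha_individually_rational
    {ι : Type*} [Fintype ι] [DecidableEq ι]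
    (α : ℝ) (hα : 1 ≤ α)
    (v : Finset ι → ℝ)
    (hv0 : v ∅ = 0)
    (hmono : ∀ A B : Finset ι, A ⊆ B → v A ≤ v B)
    (hns : ∀ A B : Finset ι, A ⊆ B → ∀ x ∉ B,
      α * (v (insert x A) - v A) ≥ v (insert x B) - v B)
    (p : ℕ → ι → ℝ) (S T : ℕ → Finset ι)
    (hp : ∀ t j, 0 ≤ p t j)
    (hS0 : S 0 = ∅)
    (hp0 : ∀ j, p 0 j = 0)
    (hdisj : ∀ t, Disjoint (S t) (T t))
    (hSnext : ∀ t, S (t + 1) ⊆ S t ∪ T t)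
    (hpkeep : ∀ t, ∀ j ∈ S t ∩ S (t + 1), p (t + 1) j = p t j)
    (hbid : ∀ t, ∀ x ∈ T t,
      v (S t ∪ T t) - v ((S t ∪ T t) \ {x}) ≥ p (t + 1) x) :
    ∀ t, ∀ S' ⊆ S t, α * v S' ≥ ∑ j ∈ S', p t j := by
  intro t
  induction t with
  | zero =>
    intro S' hS'
    rw [hS0, Finset.subset_empty] at hS'
    simp [hS', hv0]
  | succ t ih =>
    intro S' hS'
    have hnew : S' \ S t ⊆ T t := by
      intro x hx
      rw [Finset.mem_sdiff] at hx
      exact (Finset.mem_union.mp (hSnext t (hS' hx.1))).resolve_left hx.2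
    have hkept : ∑ j ∈ S' ∩ S t, p (t + 1) j = ∑ j ∈ S' ∩ S t, p t j := by
      refine Finset.sum_congr rfl fun j hj => hpkeep t j ?_
      rw [Finset.mem_inter] at hj ⊢
      exact ⟨hj.2, hS' hj.1⟩
    have hold := ih (S' ∩ S t) Finset.inter_subset_right
    have hgain := sum_le_mul_sub_of_near_submodular hns (U := S t ∪ T t) (R := S' ∩ S t)
      (Finset.inter_subset_right.trans Finset.subset_union_left) (S' \ S t)
      (hnew.trans Finset.subset_union_right) (Finset.disjoint_sdiff_inter S' (S t)).symm
      fun x hx => hbid t x (hnew hx)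
    rw [Finset.union_comm, Finset.sdiff_union_inter] at hgain
    have hsplit := Finset.sum_inter_add_sum_sdiff S' (S t) (p (t + 1))
    linarith
end

section
/- Let B be a finite set of bidders over a finite item set Ω, each with a monotone valuation v_i satisfying v_i(∅) = 0, let α ≥ 1, and let p be a price vector. Let (S_i)_{i∈B} and (S*_i)_{i∈B} be two families of pairwise disjoint subsets of Ω. Assume: (a) for every bidder i and every T ⊆ Ω \ S_i, v_i(S_i ∪ T) − p(T) ≤ v_i(S_i); (b) for every bidder i, p(S_i) ≤ α·v_i(S_i); and (c) every item j with p(j) > 0 belongs to ⋃_{i∈B} S_i. Then ∑_{i∈B} v_i(S*_i) ≤ (1 + α)·∑_{i∈B} v_i(S_i). -/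
/-- welfare guarantee of the SMRA under truthful bidding: if at termination the
empty conditional bid is optimal for every bidder, the allocation is α-individually rational,
and every positively-priced item is sold, then the optimal welfare is at most `(1 + α)` times
the welfare of the SMRA allocation. -/
theorem smra_truthful_welfare_guarantee
    {ι : Type*} [Fintype ι] [DecidableEq ι]
    {β : Type*} [Fintype β]
    (α : ℝ) (hα : 1 ≤ α)
    (v : β → Finset ι → ℝ)
    (hv0 : ∀ i, v i ∅ = 0)
    (hmono : ∀ i, ∀ A B : Finset ι, A ⊆ B → v i A ≤ v i B)
    (p : ι → ℝ) (hp : ∀ j, 0 ≤ p j)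
    (S Sstar : β → Finset ι)
    (hSdisj : ∀ i j : β, i ≠ j → Disjoint (S i) (S j))
    (hSstardisj : ∀ i j : β, i ≠ j → Disjoint (Sstar i) (Sstar j))
    (ha : ∀ i : β, ∀ T ⊆ Finset.univ \ S i,
      v i (S i ∪ T) - ∑ j ∈ T, p j ≤ v i (S i))
    (hb : ∀ i : β, ∑ j ∈ S i, p j ≤ α * v i (S i))
    (hc : ∀ j : ι, 0 < p j → ∃ i : β, j ∈ S i) :
    ∑ i : β, v i (Sstar i) ≤ (1 + α) * ∑ i : β, v i (S i) := by
  have hstar (i : β) : v i (Sstar i) ≤ v i (S i) + ∑ j ∈ Sstar i, p j := by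
    have h₁ := ha i (Sstar i \ S i) (Finset.sdiff_subset_sdiff (Finset.subset_univ _) subset_rfl)
    have h₂ := hmono i (Sstar i) (S i ∪ Sstar i \ S i) (by
      rw [Finset.union_sdiff_self_eq_union]
      exact Finset.subset_union_right)
    have h₃ : ∑ j ∈ Sstar i \ S i, p j ≤ ∑ j ∈ Sstar i, p j :=
      Finset.sum_le_sum_of_subset_of_nonneg Finset.sdiff_subset fun j _ _ => hp j
    linarith
  have hprice : ∑ i, ∑ j ∈ Sstar i, p j ≤ ∑ i, ∑ j ∈ S i, p j := by
    rw [← Finset.sum_biUnion fun i _ j _ hij => hSstardisj i j hij,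
      ← Finset.sum_biUnion fun i _ j _ hij => hSdisj i j hij]
    refine (Finset.sum_le_sum_of_subset_of_nonneg (Finset.subset_univ _)
      fun j _ _ => hp j).trans_eq (Finset.sum_subset (Finset.subset_univ _) ?_).symm
    intro j _ hj
    by_contra hne
    obtain ⟨i, hi⟩ := hc j (lt_of_le_of_ne (hp j) (Ne.symm hne))
    exact hj (Finset.mem_biUnion.mpr ⟨i, Finset.mem_univ i, hi⟩)
  calc
    ∑ i, v i (Sstar i) ≤ ∑ i, (v i (S i) + ∑ j ∈ Sstar i, p j) :=
      Finset.sum_le_sum fun i _ => hstar i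
    _ = ∑ i, v i (S i) + ∑ i, ∑ j ∈ Sstar i, p j := Finset.sum_add_distrib
    _ ≤ ∑ i, v i (S i) + ∑ i, α * v i (S i) := by
      have h := hprice.trans (Finset.sum_le_sum fun i _ => hb i)
      linarith
    _ = (1 + α) * ∑ i, v i (S i) := by
      rw [← Finset.mul_sum]
      ring
end

section
/- Let v be an α-near-submodular valuation on a finite item set Ω (α ≥ 1), let p be a price vector, and let S and S* be finite subsets of Ω. If for every item x ∈ S* \ S we have v(S ∪ {x}) − v(S) ≤ p(x), then v(S*) ≤ v(S) + α·p(S* \ S). -/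
/-- For an `α`-near-submodular set function, adding a set `T` disjoint from `S` increases the value
by at most `α` times the sum of the single-item marginals over `S`. -/
theorem le_add_mul_sum_marginals {ι : Type*} [DecidableEq ι] {α : ℝ} {v : Finset ι → ℝ}
    (hns : ∀ A B : Finset ι, A ⊆ B → ∀ x ∉ B,
      α * (v (insert x A) - v A) ≥ v (insert x B) - v B)
    {S T : Finset ι} (hST : Disjoint S T) :
    v (S ∪ T) ≤ v S + α * ∑ j ∈ T, (v (insert j S) - v S) := by
  induction T using Finset.induction_on with
  | empty => simp
  | insert x T hx ih =>
    rw [Finset.disjoint_insert_right] at hST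
    have hxST : x ∉ S ∪ T := by simp [hST.1, hx]
    have h := hns S (S ∪ T) Finset.subset_union_left x hxST
    have ih := ih hST.2
    rw [Finset.union_insert, Finset.sum_insert hx, mul_add]
    linarith

/-- single-bidder bound under locally optimal bidding: if at termination the
marginal value of each item of `S* \ S` on top of `S` is at most its price, then
`v(S*) ≤ v(S) + α·p(S* \ S)` for an α-near-submodular valuation. -/
theorem smra_local_single_bidder_bound
    {ι : Type*} [Fintype ι] [DecidableEq ι]
    (α : ℝ) (hα : 1 ≤ α)
    (v : Finset ι → ℝ)
    (hv0 : v ∅ = 0)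
    (hmono : ∀ A B : Finset ι, A ⊆ B → v A ≤ v B)
    (hns : ∀ A B : Finset ι, A ⊆ B → ∀ x ∉ B,
      α * (v (insert x A) - v A) ≥ v (insert x B) - v B)
    (p : ι → ℝ) (hp : ∀ j, 0 ≤ p j)
    (S Sstar : Finset ι)
    (hmarg : ∀ x ∈ Sstar \ S, v (insert x S) - v S ≤ p x) :
    v Sstar ≤ v S + α * ∑ j ∈ Sstar \ S, p j := by
  calc v Sstar ≤ v (S ∪ Sstar \ S) :=
        hmono _ _ (by rw [Finset.union_sdiff_self_eq_union]; exact Finset.subset_union_right)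
    _ ≤ v S + α * ∑ j ∈ Sstar \ S, (v (insert j S) - v S) :=
        le_add_mul_sum_marginals hns Finset.disjoint_sdiff
    _ ≤ v S + α * ∑ j ∈ Sstar \ S, p j := by
        gcongr with j hj
        exact hmarg j hj
end

section
/- Let B be a finite set of bidders over a finite item set Ω, each with an α-near-submodular monotone valuation v_i satisfying v_i(∅) = 0 (α ≥ 1), and let p be a price vector. Let (S_i)_{i∈B} and (S*_i)_{i∈B} be two families of pairwise disjoint subsets of Ω. Assume: (a) for every bidder i and every item x ∈ S*_i \ S_i, v_i(S_i ∪ {x}) − p(x) ≤ v_i(S_i); (b) for every bidder i, p(S_i) ≤ α·v_i(S_i); and (c) every item j with p(j) > 0 belongs to ⋃_{i∈B} S_i. Then ∑_{i∈B} v_i(S*_i) ≤ (1 + α²)·∑_{i∈B} v_i(S_i). -/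
/-- For an `α`-near-submodular set function, the gain from adjoining a set `T` is at most `α` times
the sum of the single-item marginal gains. -/
theorem union_le_add_mul_sum_marginals {ι : Type*} [DecidableEq ι] (α : ℝ) (f : Finset ι → ℝ)
    (hns : ∀ A B : Finset ι, A ⊆ B → ∀ x ∉ B,
      α * (f (insert x A) - f A) ≥ f (insert x B) - f B)
    (S T : Finset ι) (hST : Disjoint S T) :
    f (S ∪ T) ≤ f S + α * ∑ x ∈ T, (f (insert x S) - f S) := by
  induction T using Finset.induction_on with
  | empty => simp
  | insert x T hx ih =>
    rw [Finset.disjoint_insert_right] at hST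
    have h := hns S (S ∪ T) Finset.subset_union_left x (by simp [hST.1, hx])
    rw [Finset.union_insert, Finset.sum_insert hx, mul_add]
    linarith [ih hST.2]

/-- For nonnegative prices, the total price of a pairwise disjoint family of bundles is at most that
of any family containing every positively priced item. -/
theorem sum_price_le_of_disjoint_of_cover {ι β : Type*} [DecidableEq ι] [Fintype β]
    (p : ι → ℝ) (hp : ∀ j, 0 ≤ p j) (S T : β → Finset ι)
    (hS : ∀ i j : β, i ≠ j → Disjoint (S i) (S j))
    (hT : ∀ i j : β, i ≠ j → Disjoint (T i) (T j))
    (hcover : ∀ j : ι, 0 < p j → ∃ i : β, j ∈ S i) :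
    ∑ i, ∑ j ∈ T i, p j ≤ ∑ i, ∑ j ∈ S i, p j := by
  rw [← Finset.sum_biUnion fun i _ j _ h => hT i j h,
    ← Finset.sum_biUnion fun i _ j _ h => hS i j h, ← Finset.sum_filter_ne_zero]
  refine Finset.sum_le_sum_of_subset_of_nonneg (fun j hj => ?_) fun j _ _ => hp j
  simpa using hcover j ((hp j).lt_of_ne' (Finset.mem_filter.1 hj).2)


/-- welfare guarantee of the SMRA under locally optimal bidding: with
α-near-submodular valuations, single-item local optimality at termination, α-individual
rationality, and every positively-priced item sold, the optimal welfare is at most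
`(1 + α²)` times the welfare of the SMRA allocation. -/
theorem smra_local_welfare_guarantee
    {ι : Type*} [Fintype ι] [DecidableEq ι]
    {β : Type*} [Fintype β]
    (α : ℝ) (hα : 1 ≤ α)
    (v : β → Finset ι → ℝ)
    (hv0 : ∀ i, v i ∅ = 0)
    (hmono : ∀ i, ∀ A B : Finset ι, A ⊆ B → v i A ≤ v i B)
    (hns : ∀ i, ∀ A B : Finset ι, A ⊆ B → ∀ x ∉ B,
      α * (v i (insert x A) - v i A) ≥ v i (insert x B) - v i B)
    (p : ι → ℝ) (hp : ∀ j, 0 ≤ p j)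
    (S Sstar : β → Finset ι)
    (hSdisj : ∀ i j : β, i ≠ j → Disjoint (S i) (S j))
    (hSstardisj : ∀ i j : β, i ≠ j → Disjoint (Sstar i) (Sstar j))
    (ha : ∀ i : β, ∀ x ∈ Sstar i \ S i,
      v i (insert x (S i)) - p x ≤ v i (S i))
    (hb : ∀ i : β, ∑ j ∈ S i, p j ≤ α * v i (S i))
    (hc : ∀ j : ι, 0 < p j → ∃ i : β, j ∈ S i) :
    ∑ i : β, v i (Sstar i) ≤ (1 + α ^ 2) * ∑ i : β, v i (S i) := by
  have hα0 : 0 ≤ α := zero_le_one.trans hα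
  have hbidder : ∀ i, v i (Sstar i) ≤ v i (S i) + α * ∑ j ∈ Sstar i, p j := fun i =>
    calc v i (Sstar i) ≤ v i (S i ∪ (Sstar i \ S i)) := hmono i _ _ (by simp)
      _ ≤ v i (S i) + α * ∑ x ∈ Sstar i \ S i, (v i (insert x (S i)) - v i (S i)) :=
        union_le_add_mul_sum_marginals α (v i) (hns i) _ _ Finset.disjoint_sdiff
      _ ≤ v i (S i) + α * ∑ x ∈ Sstar i \ S i, p x := by
        gcongr with x hx
        linarith [ha i x hx]
      _ ≤ v i (S i) + α * ∑ j ∈ Sstar i, p j := by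
        gcongr
        · exact fun j _ _ => hp j
        · exact Finset.sdiff_subset
  calc ∑ i, v i (Sstar i) ≤ ∑ i, (v i (S i) + α * ∑ j ∈ Sstar i, p j) :=
        Finset.sum_le_sum fun i _ => hbidder i
    _ = ∑ i, v i (S i) + α * ∑ i, ∑ j ∈ Sstar i, p j := by
        rw [Finset.sum_add_distrib, Finset.mul_sum]
    _ ≤ ∑ i, v i (S i) + α * ∑ i, ∑ j ∈ S i, p j := by
        gcongr _ + α * ?_
        exact sum_price_le_of_disjoint_of_cover p hp S Sstar hSdisj hSstardisj hc
    _ ≤ ∑ i, v i (S i) + α * ∑ i, α * v i (S i) := by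
        gcongr with i
        exact hb i
    _ = (1 + α ^ 2) * ∑ i, v i (S i) := by
        rw [← Finset.mul_sum]
        ring
end

section
/- Let v be an α-near-submodular valuation on a finite item set Ω (α ≥ 1). Consider sequences indexed by rounds t ∈ ℕ: price vectors p_t, provisional sets S_t ⊆ Ω, and conditional bids T_t ⊆ Ω, satisfying: S_0 = ∅; p_0(j) = 0 for all j; for every t, T_t is disjoint from S_t; S_{t+1} ⊆ S_t ∪ T_t; p_{t+1}(j) = p_t(j) for every j ∈ S_t ∩ S_{t+1}; and each bid T_t is locally optimal in the sense that for every x ∈ T_t, v(S_t ∪ T_t) − p_{t+1}(T_t) ≥ v((S_t ∪ T_t) \ {x}) − p_{t+1}(T_t \ {x}). Then for every round t and every subset S' ⊆ S_t, α·v(S') ≥ p_t(S'); in particular the SMRA is α-individually rational under locally optimal bidding. -/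
/-- If `v` is `α`-near-submodular and the price of each item of `U` is at most its marginal value
on top of the other items of `W ⊇ A ∪ U`, then the price of `U` is at most `α` times the value
gained by adding `U` to `A`. -/
theorem sum_price_le_mul_marginal
    {ι : Type*} [DecidableEq ι] {α : ℝ} {v : Finset ι → ℝ}
    (hns : ∀ A B : Finset ι, A ⊆ B → ∀ x ∉ B,
      α * (v (insert x A) - v A) ≥ v (insert x B) - v B)
    {q : ι → ℝ} {A U W : Finset ι} (hA : A ⊆ W) (hU : U ⊆ W) (hAU : Disjoint A U)
    (hq : ∀ x ∈ U, q x ≤ v W - v (W.erase x)) :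
    ∑ j ∈ U, q j ≤ α * (v (A ∪ U) - v A) := by
  induction U using Finset.induction_on with
  | empty => simp
  | insert x U hx ih =>
    rw [Finset.disjoint_insert_right] at hAU
    rw [Finset.insert_subset_iff] at hU
    have hrest := ih hU.2 hAU.2 fun y hy => hq y (Finset.mem_insert_of_mem hy)
    have hxAU : x ∉ A ∪ U := by simp [hx, hAU.1]
    have hmarg := hns (A ∪ U) (W.erase x)
      (Finset.subset_erase.2 ⟨Finset.union_subset hA hU.2, hxAU⟩) x (Finset.notMem_erase x W)
    rw [Finset.insert_erase hU.1] at hmarg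
    have hqx := hq x (Finset.mem_insert_self x U)
    rw [Finset.sum_insert hx, Finset.union_insert]
    linarith

/-- α-individual rationality of the SMRA under locally optimal bidding: under the
round-by-round dynamics of the SMRA with an α-near-submodular valuation, if each conditional
bid is locally optimal (one-item-deletion condition), then every subset `S'` of the
provisional set at every round satisfies `α·v(S') ≥ p_t(S')`. -/
theorem smra_local_alpha_individually_rational
    {ι : Type*} [Fintype ι] [DecidableEq ι]
    (α : ℝ) (hα : 1 ≤ α)
    (v : Finset ι → ℝ)
    (hv0 : v ∅ = 0)
    (hmono : ∀ A B : Finset ι, A ⊆ B → v A ≤ v B)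
    (hns : ∀ A B : Finset ι, A ⊆ B → ∀ x ∉ B,
      α * (v (insert x A) - v A) ≥ v (insert x B) - v B)
    (p : ℕ → ι → ℝ) (S T : ℕ → Finset ι)
    (hp : ∀ t j, 0 ≤ p t j)
    (hS0 : S 0 = ∅)
    (hp0 : ∀ j, p 0 j = 0)
    (hdisj : ∀ t, Disjoint (S t) (T t))
    (hSnext : ∀ t, S (t + 1) ⊆ S t ∪ T t)
    (hpkeep : ∀ t, ∀ j ∈ S t ∩ S (t + 1), p (t + 1) j = p t j)
    (hlocal : ∀ t, ∀ x ∈ T t,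
      v (S t ∪ T t) - ∑ j ∈ T t, p (t + 1) j ≥
        v ((S t ∪ T t) \ {x}) - ∑ j ∈ T t \ {x}, p (t + 1) j) :
    ∀ t, ∀ S' ⊆ S t, α * v S' ≥ ∑ j ∈ S', p t j := by
  intro t
  induction t with
  | zero =>
    intro S' hS'
    rw [hS0, Finset.subset_empty] at hS'
    simp [hS', hv0]
  | succ t ih =>
    intro S' hS'
    have hprice : ∀ x ∈ T t, p (t + 1) x ≤ v (S t ∪ T t) - v ((S t ∪ T t).erase x) := by
      intro x hx
      have hloc := hlocal t x hx
      rw [Finset.sdiff_singleton_eq_erase, Finset.sdiff_singleton_eq_erase] at hloc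
      have hsum := Finset.add_sum_erase (T t) (p (t + 1)) hx
      linarith
    have hnew : S' \ S t ⊆ T t := sdiff_le_iff.2 (hS'.trans (hSnext t))
    have hkept : ∑ j ∈ S' ∩ S t, p (t + 1) j = ∑ j ∈ S' ∩ S t, p t j :=
      Finset.sum_congr rfl fun j hj => hpkeep t j <| by
        rw [Finset.mem_inter] at hj ⊢
        exact ⟨hj.2, hS' hj.1⟩
    have hgain := sum_price_le_mul_marginal hns
      (Finset.inter_subset_right.trans Finset.subset_union_left)
      (hnew.trans Finset.subset_union_right)
      (Finset.disjoint_sdiff_inter S' (S t)).symm fun x hx => hprice x (hnew hx)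
    rw [Finset.union_comm, Finset.sdiff_union_inter] at hgain
    have hold := ih (S' ∩ S t) Finset.inter_subset_right
    have hsplit := Finset.sum_inter_add_sum_sdiff S' (S t) (p (t + 1))
    linarith
end

section
/- Let v be an α-near-submodular valuation on a finite item set Ω (α ≥ 1), let p be a price vector, and let S and S* be finite subsets of Ω. Suppose that for every item x ∈ S* \ S there exists a set Q ⊆ S with p(x) ≥ v(Q ∪ {x}) − v(Q). Then v(S*) ≤ v(S) + α·p(S* \ S). -/
/-- Adding a set `T` disjoint from `S` to `S` raises an α-near-submodular function by at most
`α·p(T)`, if each `x ∈ T` has marginal value at most `p x` over some subset of `S`. -/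
theorem near_submodular_union_le {ι : Type*} [DecidableEq ι] {α : ℝ} (hα : 0 ≤ α)
    {v : Finset ι → ℝ}
    (hns : ∀ A B : Finset ι, A ⊆ B → ∀ x ∉ B,
      α * (v (insert x A) - v A) ≥ v (insert x B) - v B)
    {p : ι → ℝ} {S : Finset ι} (T : Finset ι) (hdisj : ∀ x ∈ T, x ∉ S)
    (hwit : ∀ x ∈ T, ∃ Q ⊆ S, p x ≥ v (insert x Q) - v Q) :
    v (S ∪ T) ≤ v S + α * ∑ j ∈ T, p j := by
  induction T using Finset.induction_on with
  | empty => simp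
  | insert x T hxT ih =>
    have hT := ih (fun y hy => hdisj y (Finset.mem_insert_of_mem hy))
      (fun y hy => hwit y (Finset.mem_insert_of_mem hy))
    obtain ⟨Q, hQS, hQ⟩ := hwit x (Finset.mem_insert_self x T)
    have hx : x ∉ S ∪ T := by
      simp [hxT, hdisj x (Finset.mem_insert_self x T)]
    have hmarg := hns Q (S ∪ T) (hQS.trans Finset.subset_union_left) x hx
    have hprice := mul_le_mul_of_nonneg_left hQ hα
    rw [Finset.union_insert, Finset.sum_insert hxT, mul_add]
    linarith

/-- single-bidder bound under profit-maximizing secure bidding: if for every item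
`x ∈ S* \ S` some `Q ⊆ S` witnesses `p(x) ≥ v(Q ∪ {x}) − v(Q)`, then
`v(S*) ≤ v(S) + α·p(S* \ S)` for an α-near-submodular valuation. -/
theorem smra_secure_single_bidder_bound
    {ι : Type*} [Fintype ι] [DecidableEq ι]
    (α : ℝ) (hα : 1 ≤ α)
    (v : Finset ι → ℝ)
    (hv0 : v ∅ = 0)
    (hmono : ∀ A B : Finset ι, A ⊆ B → v A ≤ v B)
    (hns : ∀ A B : Finset ι, A ⊆ B → ∀ x ∉ B,
      α * (v (insert x A) - v A) ≥ v (insert x B) - v B)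
    (p : ι → ℝ) (hp : ∀ j, 0 ≤ p j)
    (S Sstar : Finset ι)
    (hwit : ∀ x ∈ Sstar \ S, ∃ Q ⊆ S, p x ≥ v (insert x Q) - v Q) :
    v Sstar ≤ v S + α * ∑ j ∈ Sstar \ S, p j := by
  have hle := near_submodular_union_le (zero_le_one.trans hα) hns (Sstar \ S)
    (fun x hx => (Finset.mem_sdiff.mp hx).2) hwit
  rw [Finset.union_sdiff_self_eq_union] at hle
  exact (hmono _ _ Finset.subset_union_right).trans hle
end

section
/- Let B be a finite set of bidders over a finite item set Ω, each with an α-near-submodular monotone valuation v_i satisfying v_i(∅) = 0 (α ≥ 1), and let p be a price vector. Let (S_i)_{i∈B} and (S*_i)_{i∈B} be two families of pairwise disjoint subsets of Ω. Assume: (a) for every bidder i and every item x ∈ S*_i \ S_i, there exists Q ⊆ S_i with p(x) ≥ v_i(Q ∪ {x}) − v_i(Q); (b) for every bidder i, p(S_i) ≤ v_i(S_i); and (c) every item j with p(j) > 0 belongs to ⋃_{i∈B} S_i. Then ∑_{i∈B} v_i(S*_i) ≤ (1 + α)·∑_{i∈B} v_i(S_i). -/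
/-- If each item of `T` outside `S` has a price that dominates its marginal value at some subset of
`S`, then adding `T` to `S` raises an `α`-near-submodular valuation by at most `α` times the price
of `T`. -/
theorem le_add_mul_sum_of_marginal_le
    {ι : Type*} [DecidableEq ι] {α : ℝ} (hα : 0 ≤ α) {v : Finset ι → ℝ}
    (hns : ∀ A B : Finset ι, A ⊆ B → ∀ x ∉ B,
      α * (v (insert x A) - v A) ≥ v (insert x B) - v B)
    {p : ι → ℝ} (hp : ∀ j, 0 ≤ p j) {S T : Finset ι}
    (h : ∀ x ∈ T \ S, ∃ Q ⊆ S, p x ≥ v (insert x Q) - v Q) :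
    v (S ∪ T) ≤ v S + α * ∑ j ∈ T, p j := by
  induction T using Finset.induction_on with
  | empty => simp
  | insert x T hx ih =>
    have ih := ih fun y hy => h y
      (Finset.sdiff_subset_sdiff (Finset.subset_insert x T) subset_rfl hy)
    rw [Finset.sum_insert hx, Finset.union_insert, mul_add]
    by_cases hxS : x ∈ S
    · rw [Finset.insert_eq_of_mem (Finset.mem_union_left T hxS)]
      linarith [mul_nonneg hα (hp x)]
    · obtain ⟨Q, hQ, hpQ⟩ := h x (by simp [hxS])
      have hmarg := hns Q (S ∪ T) (hQ.trans Finset.subset_union_left) x (by simp [hx, hxS])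
      linarith [mul_le_mul_of_nonneg_left hpQ.le hα]

/-- If every positively priced item belongs to some `S i`, a disjoint family costs at most as much
as the disjoint family `S`. -/
theorem sum_sum_price_le_of_pos_covered
    {ι β : Type*} [Fintype ι] [DecidableEq ι] [Fintype β] {p : ι → ℝ} (hp : ∀ j, 0 ≤ p j)
    {S T : β → Finset ι}
    (hS : ∀ i j : β, i ≠ j → Disjoint (S i) (S j))
    (hT : ∀ i j : β, i ≠ j → Disjoint (T i) (T j))
    (hc : ∀ j : ι, 0 < p j → ∃ i : β, j ∈ S i) :
    ∑ i, ∑ j ∈ T i, p j ≤ ∑ i, ∑ j ∈ S i, p j := by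
  rw [← Finset.sum_biUnion fun i _ j _ hij => hT i j hij,
    ← Finset.sum_biUnion fun i _ j _ hij => hS i j hij]
  calc ∑ j ∈ Finset.univ.biUnion T, p j
      ≤ ∑ j, p j :=
        Finset.sum_le_sum_of_subset_of_nonneg (Finset.subset_univ _) fun j _ _ => hp j
    _ = ∑ j ∈ Finset.univ.biUnion S, p j := by
        refine (Finset.sum_subset (Finset.subset_univ _) fun j _ hj => ?_).symm
        by_contra hne
        obtain ⟨i, hi⟩ := hc j ((hp j).lt_of_ne' hne)
        exact hj (Finset.mem_biUnion.2 ⟨i, Finset.mem_univ i, hi⟩)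

/-- welfare guarantee of the SMRA under profit-maximizing secure bidding: with
α-near-submodular valuations, the marginal witness condition at termination, individual
rationality, and every positively-priced item sold, the optimal welfare is at most `(1 + α)`
times the welfare of the SMRA allocation. -/
theorem smra_secure_welfare_guarantee
    {ι : Type*} [Fintype ι] [DecidableEq ι]
    {β : Type*} [Fintype β]
    (α : ℝ) (hα : 1 ≤ α)
    (v : β → Finset ι → ℝ)
    (hv0 : ∀ i, v i ∅ = 0)
    (hmono : ∀ i, ∀ A B : Finset ι, A ⊆ B → v i A ≤ v i B)
    (hns : ∀ i, ∀ A B : Finset ι, A ⊆ B → ∀ x ∉ B,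
      α * (v i (insert x A) - v i A) ≥ v i (insert x B) - v i B)
    (p : ι → ℝ) (hp : ∀ j, 0 ≤ p j)
    (S Sstar : β → Finset ι)
    (hSdisj : ∀ i j : β, i ≠ j → Disjoint (S i) (S j))
    (hSstardisj : ∀ i j : β, i ≠ j → Disjoint (Sstar i) (Sstar j))
    (ha : ∀ i : β, ∀ x ∈ Sstar i \ S i,
      ∃ Q ⊆ S i, p x ≥ v i (insert x Q) - v i Q)
    (hb : ∀ i : β, ∑ j ∈ S i, p j ≤ v i (S i))
    (hc : ∀ j : ι, 0 < p j → ∃ i : β, j ∈ S i) :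
    ∑ i : β, v i (Sstar i) ≤ (1 + α) * ∑ i : β, v i (S i) := by
  have hα0 : 0 ≤ α := zero_le_one.trans hα
  calc ∑ i, v i (Sstar i)
      ≤ ∑ i, (v i (S i) + α * ∑ j ∈ Sstar i, p j) :=
        Finset.sum_le_sum fun i _ => (hmono i _ _ Finset.subset_union_right).trans
          (le_add_mul_sum_of_marginal_le hα0 (hns i) hp (ha i))
    _ = ∑ i, v i (S i) + α * ∑ i, ∑ j ∈ Sstar i, p j := by
        rw [Finset.sum_add_distrib, Finset.mul_sum]
    _ ≤ ∑ i, v i (S i) + α * ∑ i, v i (S i) := by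
        refine add_le_add le_rfl (mul_le_mul_of_nonneg_left ?_ hα0)
        exact (sum_sum_price_le_of_pos_covered hp hSdisj hSstardisj hc).trans
          (Finset.sum_le_sum fun i _ => hb i)
    _ = (1 + α) * ∑ i, v i (S i) := by ring
end

section
/- Let α ≥ 1 be a real number and let Ω be a finite item set. Define f on finite subsets of Ω by f(∅) = 0, f(S) = 1 if |S| = 1, and f(S) = (|S| − 1)·α + 1 if |S| ≥ 2. Then f is monotone and α-near-submodular: for all A ⊆ B ⊆ Ω and every x ∉ B, α·(f(A ∪ {x}) − f(A)) ≥ f(B ∪ {x}) − f(B). -/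
/-- the valuation used for the tightness of the truthful-bidding bicriteria
guarantees: `f(∅) = 0`, `f(S) = 1` for `|S| = 1`, `f(S) = (|S| − 1)·α + 1` for `|S| ≥ 2`,
is monotone and α-near-submodular. -/
theorem truthful_tightness_valuation_near_submodular
    {ι : Type*} [Fintype ι] [DecidableEq ι]
    (α : ℝ) (hα : 1 ≤ α)
    (f : Finset ι → ℝ)
    (hf0 : f ∅ = 0)
    (hf1 : ∀ S : Finset ι, S.card = 1 → f S = 1)
    (hf2 : ∀ S : Finset ι, 2 ≤ S.card → f S = ((S.card : ℝ) - 1) * α + 1) :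
    (∀ A B : Finset ι, A ⊆ B → f A ≤ f B) ∧
    (∀ A B : Finset ι, A ⊆ B → ∀ x ∉ B,
      α * (f (insert x A) - f A) ≥ f (insert x B) - f B) := by
  have f_nonempty : ∀ S : Finset ι, S.Nonempty → f S = ((S.card : ℝ) - 1) * α + 1 := by
    intro S hS
    rcases (Nat.succ_le_of_lt hS.card_pos).eq_or_lt with h | h
    · rw [hf1 S h.symm, ← h]
      simp
    · exact hf2 S h
  have f_insert : ∀ (S : Finset ι) (x : ι), x ∉ S → f (insert x S) = S.card * α + 1 := by
    intro S x hx
    rw [f_nonempty _ (Finset.insert_nonempty x S), Finset.card_insert_of_notMem hx]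
    push_cast
    ring
  refine ⟨fun A B hAB => ?_, fun A B hAB x hx => ?_⟩
  · rcases A.eq_empty_or_nonempty with rfl | hA
    · rcases B.eq_empty_or_nonempty with rfl | hB
      · exact le_rfl
      · have hcard : (1 : ℝ) ≤ B.card := by exact_mod_cast hB.card_pos
        rw [hf0, f_nonempty B hB]
        nlinarith
    · have hcard : (A.card : ℝ) ≤ B.card := by exact_mod_cast Finset.card_le_card hAB
      rw [f_nonempty A hA, f_nonempty B (hA.mono hAB)]
      nlinarith
  · rw [f_insert A x (fun h => hx (hAB h)), f_insert B x hx]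
    rcases A.eq_empty_or_nonempty with rfl | hA
    · rcases B.eq_empty_or_nonempty with rfl | hB
      · simpa [hf0] using hα
      · rw [hf0, f_nonempty B hB, Finset.card_empty]
        push_cast
        linarith
    · rw [f_nonempty A hA, f_nonempty B (hA.mono hAB)]
      nlinarith
end

section
/- Let α ≥ 1 be a real number and let Ω be a finite item set. Define g on finite subsets of Ω by g(∅) = 0, g(S) = α if |S| = 1, and g(S) = (|S| − 1)·α² + α if |S| ≥ 2. Then g is monotone and α-near-submodular: for all A ⊆ B ⊆ Ω and every x ∉ B, α·(g(A ∪ {x}) − g(A)) ≥ g(B ∪ {x}) − g(B). -/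
/-- the Type I bidder valuation used for the tightness of the locally-optimal
bidding bicriteria guarantees: `g(∅) = 0`, `g(S) = α` for `|S| = 1`,
`g(S) = (|S| − 1)·α² + α` for `|S| ≥ 2`, is monotone and α-near-submodular. -/
theorem local_tightness_typeI_valuation_near_submodular
    {ι : Type*} [Fintype ι] [DecidableEq ι]
    (α : ℝ) (hα : 1 ≤ α)
    (g : Finset ι → ℝ)
    (hg0 : g ∅ = 0)
    (hg1 : ∀ S : Finset ι, S.card = 1 → g S = α)
    (hg2 : ∀ S : Finset ι, 2 ≤ S.card → g S = ((S.card : ℝ) - 1) * α ^ 2 + α) :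
    (∀ A B : Finset ι, A ⊆ B → g A ≤ g B) ∧
    (∀ A B : Finset ι, A ⊆ B → ∀ x ∉ B,
      α * (g (insert x A) - g A) ≥ g (insert x B) - g B) := by
  have formula : ∀ S : Finset ι, S.Nonempty → g S = ((S.card : ℝ) - 1) * α ^ 2 + α := by
    intro S hS
    rcases Nat.lt_or_ge S.card 2 with h | h
    · have h1 : S.card = 1 := by
        have := hS.card_pos
        omega
      simp [hg1 S h1, h1]
    · exact hg2 S h
  have marginal_empty : ∀ x : ι, g (insert x ∅) - g ∅ = α := by
    intro x
    rw [hg0, hg1 _ (by simp), sub_zero]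
  have marginal : ∀ S : Finset ι, S.Nonempty → ∀ x ∉ S, g (insert x S) - g S = α ^ 2 := by
    intro S hS x hx
    rw [formula S hS, formula _ (Finset.insert_nonempty x S), Finset.card_insert_of_notMem hx]
    push_cast
    ring
  refine ⟨fun A B hAB => ?_, fun A B hAB x hx => ?_⟩
  · rcases A.eq_empty_or_nonempty with rfl | hA
    · rcases B.eq_empty_or_nonempty with rfl | hB
      · exact le_rfl
      · have hcard : (1 : ℝ) ≤ B.card := by exact_mod_cast hB.card_pos
        rw [hg0, formula B hB]
        have := mul_nonneg (sub_nonneg.2 hcard) (sq_nonneg α)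
        linarith
    · rw [formula A hA, formula B (hA.mono hAB)]
      have hcard : (A.card : ℝ) ≤ B.card := by exact_mod_cast Finset.card_le_card hAB
      gcongr
  · rcases A.eq_empty_or_nonempty with rfl | hA
    · rw [marginal_empty]
      rcases B.eq_empty_or_nonempty with rfl | hB
      · rw [marginal_empty]
        nlinarith
      · rw [marginal B hB x hx]
        exact (sq α).le
    · rw [marginal A hA x (fun h => hx (hAB h)), marginal B (hA.mono hAB) x hx]
      exact le_mul_of_one_le_left (sq_nonneg α) hα
end

section
/- Let α and H be real numbers with α ≥ 1 and H ≥ α. Let Ω = {a, z} be a two-element item set and define v on subsets of Ω by v(∅) = 0, v({a}) = 1, v({z}) = H, and v({a, z}) = H + α. Then v is monotone and α-near-submodular: for all A ⊆ B ⊆ Ω and every x ∉ B, α·(v(A ∪ {x}) − v(A)) ≥ v(B ∪ {x}) − v(B). -/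
/-- the Type II bidder valuation on the two-element item set `Ω = {a, z}` with
`v(∅) = 0`, `v({a}) = 1`, `v({z}) = H`, `v({a,z}) = H + α` (where `1 ≤ α ≤ H`) is monotone
and α-near-submodular on subsets of `Ω`. -/
theorem local_tightness_typeII_valuation_near_submodular
    {ι : Type*} [DecidableEq ι]
    (α H : ℝ) (hα : 1 ≤ α) (hH : α ≤ H)
    (a z : ι) (haz : a ≠ z)
    (v : Finset ι → ℝ)
    (hv0 : v ∅ = 0)
    (hva : v {a} = 1)
    (hvz : v {z} = H)
    (hvaz : v {a, z} = H + α) :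
    (∀ A B : Finset ι, A ⊆ B → B ⊆ {a, z} → v A ≤ v B) ∧
    (∀ A B : Finset ι, A ⊆ B → B ⊆ ({a, z} : Finset ι) → ∀ x ∈ ({a, z} : Finset ι), x ∉ B →
      α * (v (insert x A) - v A) ≥ v (insert x B) - v B) := by
  have hsub : ∀ S : Finset ι, S ⊆ {a, z} → S = ∅ ∨ S = {a} ∨ S = {z} ∨ S = {a, z} := by
    intro S hS
    rw [← Finset.coe_subset, Finset.coe_pair, Set.subset_pair_iff_eq] at hS
    exact_mod_cast hS
  have hvza : v {z, a} = H + α := by rw [Finset.pair_comm, hvaz]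
  have hza : z ≠ a := haz.symm
  have hnot_a : ¬ ({a, z} : Finset ι) ⊆ {a} := fun h =>
    hza (Finset.mem_singleton.mp (h (by simp)))
  have hnot_z : ¬ ({a, z} : Finset ι) ⊆ {z} := fun h =>
    haz (Finset.mem_singleton.mp (h (by simp)))
  constructor
  · intro A B hAB hB
    rcases hsub B hB with rfl | rfl | rfl | rfl <;>
      rcases hsub A (hAB.trans hB) with rfl | rfl | rfl | rfl <;>
      first
      | (simp only [hv0, hva, hvz, hvaz]; linarith)
      | exact absurd hAB hnot_a
      | exact absurd hAB hnot_z
      | (exfalso; simp [hza] at hAB)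
  · intro A B hAB hB x hx hxB
    rcases Finset.mem_insert.mp hx with rfl | hx
    on_goal 2 => obtain rfl := Finset.mem_singleton.mp hx
    all_goals
      rcases hsub B hB with rfl | rfl | rfl | rfl <;>
      rcases hsub A (hAB.trans hB) with rfl | rfl | rfl | rfl <;>
      first
      | (exfalso; simp [haz, hza] at hxB; done)
      | exact absurd hAB hnot_a
      | exact absurd hAB hnot_z
      | (exfalso; simp [haz, hza] at hAB; done)
      | (simp only [insert_empty_eq, hv0, hva, hvz, hvaz, hvza]
         nlinarith [mul_nonneg (sub_nonneg.mpr hα) (sub_nonneg.mpr (hα.trans hH)),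
           mul_nonneg (sub_nonneg.mpr hα) (sub_nonneg.mpr hα)])
end
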